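/- Let J ≥ 1, let α₁, …, α_J be complex numbers in the open unit disk 𝔻, let G be holomorphic on an open neighborhood of the closed unit disk with G(z) ≠ 0 for all |z| ≤ 1, let B(z) = ∏_{j=1}^{J} (z − α_j)/(1 − \overline{α_j} z), and set F = B · G. Then ∫_𝔻 |G′(z)|² dA(z) ≤ ∫_𝔻 |F′(z)|² dA(z), where dA is two-dimensional Lebesgue measure on the open unit disk; that is, the Dirichlet-space norm does not increase when a Blaschke product is factored out. -/

import Mathlib

open Real MeasureTheory

open Metric ComplexConjugate

/-! ### Square-integral of a power series over the unit disk -/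

theorem integral_ball_norm_pow_two_mul (n : ℕ) :
    ∫ z in ball (0 : ℂ) 1, ‖z‖ ^ (2 * n) = π / (n + 1) := by
  have h := integral_fun_norm_addHaar (volume : Measure ℂ)
    ((Set.Iio (1 : ℝ)).indicator fun r ↦ r ^ (2 * n))
  have hl : ∀ z : ℂ, (Set.Iio (1 : ℝ)).indicator (fun r ↦ r ^ (2 * n)) ‖z‖ =
      (ball (0 : ℂ) 1).indicator (fun z ↦ ‖z‖ ^ (2 * n)) z := by
    intro z
    by_cases hz : ‖z‖ < 1 <;> simp [Set.indicator, hz]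
  have hr : ∀ y : ℝ, y ^ (Module.finrank ℝ ℂ - 1) •
      (Set.Iio (1 : ℝ)).indicator (fun r ↦ r ^ (2 * n)) y =
      (Set.Iio (1 : ℝ)).indicator (fun r ↦ r ^ (2 * n + 1)) y := by
    intro y
    by_cases hy : y < 1 <;> simp [Set.indicator, hy, Complex.finrank_real_complex, pow_succ']
  simp_rw [hl, hr] at h
  rw [integral_indicator measurableSet_ball, setIntegral_indicator measurableSet_Iio,
    Set.Ioi_inter_Iio, ← integral_Ioc_eq_integral_Ioo,
    ← intervalIntegral.integral_of_le zero_le_one, integral_pow] at h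
  rw [h, measureReal_def, Complex.volume_ball, Complex.finrank_real_complex]
  simp
  field_simp
  ring

theorem integral_ball_pow_mul_conj_pow_of_ne {n m : ℕ} (hnm : n ≠ m) :
    ∫ z in ball (0 : ℂ) 1, z ^ n * conj z ^ m = 0 := by
  obtain ⟨c, hc⟩ : ∃ c : Circle, (c : ℂ) ^ n * conj (c : ℂ) ^ m = -1 := by
    refine ⟨Circle.exp (π / ((n : ℝ) - m)), ?_⟩
    have hne : (n : ℂ) - m ≠ 0 := sub_ne_zero.2 (Nat.cast_injective.ne hnm)
    rw [Circle.coe_exp, ← Complex.exp_conj, ← Complex.exp_nat_mul, ← Complex.exp_nat_mul,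
      ← Complex.exp_add, ← Complex.exp_pi_mul_I]
    congr 1
    simp
    field_simp
    ring
  have hrot := (rotation c).measurePreserving.setIntegral_preimage_emb
    (rotation c).toHomeomorph.measurableEmbedding
    (fun z : ℂ ↦ z ^ n * conj z ^ m) (ball 0 1)
  have hpre : rotation c ⁻¹' ball (0 : ℂ) 1 = ball 0 1 := by
    ext z
    rw [Set.mem_preimage, mem_ball_zero_iff, mem_ball_zero_iff, LinearIsometryEquiv.norm_map]
  have hmul : ∀ z : ℂ, rotation c z ^ n * conj (rotation c z) ^ m =
      -1 * (z ^ n * conj z ^ m) := by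
    intro z
    rw [← hc, rotation_apply, map_mul, mul_pow, mul_pow]
    ring
  simp_rw [hpre, hmul] at hrot
  rw [integral_const_mul] at hrot
  linear_combination (-1 / 2 : ℂ) * hrot

theorem integral_ball_pow_mul_conj_pow_self (n : ℕ) :
    ∫ z in ball (0 : ℂ) 1, z ^ n * conj z ^ n = (π / (n + 1) : ℝ) := by
  rw [← integral_ball_norm_pow_two_mul, ← integral_complex_ofReal]
  congr 1 with z
  rw [← mul_pow, Complex.mul_conj, Complex.normSq_eq_norm_sq, pow_mul]
  push_cast
  rfl

/-- Parseval's identity for the area integral over the unit disk. -/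
theorem hasSum_integral_ball_norm_sq {c : ℕ → ℂ} (hc : Summable fun n ↦ ‖c n‖) {h : ℂ → ℂ}
    (hh : ∀ z ∈ ball (0 : ℂ) 1, HasSum (fun n ↦ c n * z ^ n) (h z)) :
    HasSum (fun n ↦ ‖c n‖ ^ 2 * (π / (n + 1))) (∫ z in ball (0 : ℂ) 1, ‖h z‖ ^ 2) := by
  set f : ℕ × ℕ → ℂ → ℂ := fun p z ↦ c p.1 * conj (c p.2) * (z ^ p.1 * conj z ^ p.2) with hf
  have hcont : ∀ p, Continuous (f p) := fun p ↦ by fun_prop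
  have hint : ∀ p, IntegrableOn (f p) (ball 0 1) := fun p ↦
    ((hcont p).continuousOn.integrableOn_compact (isCompact_closedBall 0 1)).mono_set
      ball_subset_closedBall
  have hfle : ∀ p, ∀ z ∈ ball (0 : ℂ) 1, ‖f p z‖ ≤ ‖c p.1‖ * ‖c p.2‖ := by
    intro p z hz
    have hz' : ‖z‖ ≤ 1 := (mem_ball_zero_iff.1 hz).le
    simp only [hf, norm_mul, norm_pow, Complex.norm_conj]
    exact mul_le_of_le_one_right (by positivity)
      (mul_le_one₀ (pow_le_one₀ (norm_nonneg _) hz') (by positivity)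
        (pow_le_one₀ (norm_nonneg _) hz'))
  have hprod : Summable fun p : ℕ × ℕ ↦ ‖c p.1‖ * ‖c p.2‖ :=
    hc.mul_of_nonneg hc (fun _ ↦ norm_nonneg _) (fun _ ↦ norm_nonneg _)
  have hsum : Summable fun p ↦ ∫ z in ball (0 : ℂ) 1, ‖f p z‖ := by
    refine (hprod.mul_left π).of_nonneg_of_le
      (fun p ↦ integral_nonneg fun z ↦ norm_nonneg _) fun p ↦ ?_
    refine (setIntegral_mono_on (hint p).norm (integrableOn_const (by simp))
      measurableSet_ball (hfle p)).trans ?_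
    simp [measureReal_def, Complex.volume_ball]
  have key := hasSum_integral_of_summable_integral_norm hint hsum
  have hval : ∫ z in ball (0 : ℂ) 1, ∑' p, f p z =
      ((∫ z in ball (0 : ℂ) 1, ‖h z‖ ^ 2 : ℝ) : ℂ) := by
    rw [← integral_complex_ofReal]
    refine setIntegral_congr_fun measurableSet_ball fun z hz ↦ ?_
    have h1 := hh z hz
    have h2 : HasSum (fun n ↦ conj (c n) * conj z ^ n) (conj (h z)) := by
      simpa using Complex.hasSum_conj'.2 h1
    have hs : Summable fun p : ℕ × ℕ ↦ (c p.1 * z ^ p.1) * (conj (c p.2) * conj z ^ p.2) :=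
      .of_norm_bounded hprod fun p ↦ by
        refine le_of_eq_of_le (congrArg norm ?_) (hfle p z hz)
        simp only [hf]; ring
    have h3 := (h1.mul h2 hs).tsum_eq
    rw [Complex.mul_conj, Complex.normSq_eq_norm_sq] at h3
    rw [← h3]
    refine tsum_congr fun p ↦ ?_
    simp only [hf]; ring
  rw [hval] at key
  have hinj : Function.Injective fun n : ℕ ↦ (n, n) := fun a b hab ↦ congrArg Prod.fst hab
  rw [← hinj.hasSum_iff] at key
  · rw [← Complex.hasSum_ofReal]
    refine key.congr_fun fun n ↦ ?_
    simp only [hf, Function.comp]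
    rw [integral_const_mul, integral_ball_pow_mul_conj_pow_self, Complex.mul_conj,
      Complex.normSq_eq_norm_sq]
    push_cast
    rfl
  · rintro ⟨n, m⟩ hp
    have hnm : n ≠ m := by
      rintro rfl
      exact hp ⟨n, rfl⟩
    simp only [hf]
    rw [integral_const_mul, integral_ball_pow_mul_conj_pow_of_ne hnm, mul_zero]

/-! ### Multiplication by the coordinate -/

theorem exists_one_lt_differentiableOn_ball {f : ℂ → ℂ}
    (hf : AnalyticOnNhd ℂ f (closedBall 0 1)) : ∃ r > 1, DifferentiableOn ℂ f (ball 0 r) := by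
  obtain ⟨δ, hδ, hsub⟩ := (isCompact_closedBall (0 : ℂ) 1).exists_thickening_subset_open
    (isOpen_analyticAt ℂ f) hf
  rw [thickening_closedBall hδ zero_le_one] at hsub
  exact ⟨δ + 1, by linarith, fun z hz ↦ (hsub hz).differentiableAt.differentiableWithinAt⟩

theorem integral_norm_deriv_sq_le_id_mul {g : ℂ → ℂ} (hg : AnalyticOnNhd ℂ g (closedBall 0 1)) :
    ∫ z in ball (0 : ℂ) 1, ‖deriv g z‖ ^ 2 ≤
      ∫ z in ball (0 : ℂ) 1, ‖deriv (fun w ↦ w * g w) z‖ ^ 2 := by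
  obtain ⟨r, hr, hd⟩ := exists_one_lt_differentiableOn_ball hg
  set a : ℕ → ℂ := fun n ↦ (n.factorial : ℂ)⁻¹ * iteratedDeriv n g 0 with ha
  have hsg : ∀ z ∈ ball (0 : ℂ) r, HasSum (fun n ↦ a n * z ^ n) (g z) := by
    intro z hz
    refine (Complex.hasSum_taylorSeries_on_ball hd hz).congr_fun fun n ↦ ?_
    simp only [ha, sub_zero, smul_eq_mul]; ring
  have hsd : ∀ z ∈ ball (0 : ℂ) r,
      HasSum (fun n : ℕ ↦ (n + 1) * a (n + 1) * z ^ n) (deriv g z) := by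
    intro z hz
    refine (Complex.hasSum_taylorSeries_on_ball (hd.deriv isOpen_ball) hz).congr_fun fun n ↦ ?_
    have : (n : ℂ) + 1 ≠ 0 := Nat.cast_add_one_ne_zero n
    simp only [ha, sub_zero, smul_eq_mul, iteratedDeriv_succ', Nat.factorial_succ]
    push_cast
    field_simp
  have hsm : ∀ z ∈ ball (0 : ℂ) r,
      HasSum (fun n : ℕ ↦ (n + 1) * a n * z ^ n) (deriv (fun w ↦ w * g w) z) := by
    intro z hz
    have hgz := hd.differentiableAt (isOpen_ball.mem_nhds hz)
    have hzd : HasSum (fun n : ℕ ↦ n * a n * z ^ n) (z * deriv g z) := by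
      refine (hasSum_nat_add_iff' 1).1 ?_
      simp only [Finset.sum_range_one, Nat.cast_zero, zero_mul, sub_zero]
      refine ((hsd z hz).mul_left z).congr_fun fun n ↦ ?_
      push_cast
      ring
    rw [((hasDerivAt_id' z).fun_mul hgz.hasDerivAt).deriv]
    refine (((hsg z hz).mul_left 1).add hzd).congr_fun fun n ↦ ?_
    ring
  have h1 : (1 : ℂ) ∈ ball (0 : ℂ) r := by simpa using hr
  have hsub : ball (0 : ℂ) 1 ⊆ ball 0 r := ball_subset_ball hr.le
  have hEd := hasSum_integral_ball_norm_sq (by simpa using (hsd 1 h1).summable.norm)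
    fun z hz ↦ hsd z (hsub hz)
  have hEm := hasSum_integral_ball_norm_sq (by simpa using (hsm 1 h1).summable.norm)
    fun z hz ↦ hsm z (hsub hz)
  have hEd' : HasSum (fun n : ℕ ↦ π * n * ‖a n‖ ^ 2) (∫ z in ball (0 : ℂ) 1, ‖deriv g z‖ ^ 2) := by
    refine (hasSum_nat_add_iff' 1).1 ?_
    simp only [Finset.sum_range_one, Nat.cast_zero, mul_zero, zero_mul, sub_zero]
    refine hEd.congr_fun fun n ↦ ?_
    have hn : ‖(n : ℂ) + 1‖ = n + 1 := mod_cast Complex.norm_natCast (n + 1)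
    rw [norm_mul ((n : ℂ) + 1), hn]
    push_cast
    field_simp
  refine hasSum_le (fun n ↦ ?_) hEd' hEm
  have hn : ‖(n : ℂ) + 1‖ = n + 1 := mod_cast Complex.norm_natCast (n + 1)
  rw [norm_mul ((n : ℂ) + 1), hn]
  have : ((n + 1) * ‖a n‖) ^ 2 * (π / (n + 1)) = π * n * ‖a n‖ ^ 2 + π * ‖a n‖ ^ 2 := by
    field_simp
  rw [this]
  exact le_add_of_nonneg_right (by positivity)

/-! ### Disk involutions -/

/-- The involutive automorphism of the unit disk exchanging `0` and `a`. -/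
noncomputable def diskInvolution (a z : ℂ) : ℂ := (a - z) / (1 - conj a * z)

section diskInvolution

variable {a z : ℂ}

theorem one_sub_conj_mul_ne_zero (ha : ‖a‖ < 1) (hz : ‖z‖ ≤ 1) : 1 - conj a * z ≠ 0 := by
  intro h
  have h1 : ‖conj a * z‖ = 1 := by rw [← sub_eq_zero.1 h, norm_one]
  rw [norm_mul, Complex.norm_conj] at h1
  nlinarith [norm_nonneg a, norm_nonneg z]

theorem norm_sq_one_sub_conj_mul_sub (a z : ℂ) :
    ‖1 - conj a * z‖ ^ 2 - ‖a - z‖ ^ 2 = (1 - ‖a‖ ^ 2) * (1 - ‖z‖ ^ 2) := by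
  simp only [← Complex.normSq_eq_norm_sq, Complex.normSq_apply]
  simp
  ring

theorem norm_diskInvolution_le_one (ha : ‖a‖ < 1) (hz : ‖z‖ ≤ 1) : ‖diskInvolution a z‖ ≤ 1 := by
  have := norm_sq_one_sub_conj_mul_sub a z
  have := mul_nonneg (by nlinarith [norm_nonneg a] : 0 ≤ 1 - ‖a‖ ^ 2)
    (by nlinarith [norm_nonneg z] : 0 ≤ 1 - ‖z‖ ^ 2)
  rw [diskInvolution, norm_div]
  exact div_le_one_of_le₀ (le_of_sq_le_sq (by linarith) (norm_nonneg _)) (norm_nonneg _)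

theorem norm_diskInvolution_lt_one (ha : ‖a‖ < 1) (hz : ‖z‖ < 1) : ‖diskInvolution a z‖ < 1 := by
  have := norm_sq_one_sub_conj_mul_sub a z
  have := mul_pos (by nlinarith [norm_nonneg a] : 0 < 1 - ‖a‖ ^ 2)
    (by nlinarith [norm_nonneg z] : 0 < 1 - ‖z‖ ^ 2)
  rw [diskInvolution, norm_div,
    div_lt_one (norm_pos_iff.2 (one_sub_conj_mul_ne_zero ha hz.le))]
  exact lt_of_pow_lt_pow_left₀ 2 (norm_nonneg _) (by linarith)

theorem diskInvolution_diskInvolution (ha : ‖a‖ < 1) (hz : ‖z‖ ≤ 1) :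
    diskInvolution a (diskInvolution a z) = z := by
  have h1 : diskInvolution a z * (1 - conj a * z) = a - z :=
    div_mul_cancel₀ _ (one_sub_conj_mul_ne_zero ha hz)
  have h2 := one_sub_conj_mul_ne_zero ha (norm_diskInvolution_le_one ha hz)
  rw [diskInvolution, div_eq_iff h2]
  linear_combination -h1

theorem analyticAt_diskInvolution (ha : ‖a‖ < 1) (hz : ‖z‖ ≤ 1) :
    AnalyticAt ℂ (diskInvolution a) z := by
  unfold diskInvolution
  exact (analyticAt_const.sub analyticAt_id).div
    (analyticAt_const.sub (analyticAt_const.mul analyticAt_id)) (one_sub_conj_mul_ne_zero ha hz)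

theorem image_diskInvolution_ball (ha : ‖a‖ < 1) :
    diskInvolution a '' ball 0 1 = ball 0 1 := by
  ext w
  simp only [Set.mem_image, mem_ball_zero_iff]
  constructor
  · rintro ⟨z, hz, rfl⟩
    exact norm_diskInvolution_lt_one ha hz
  · exact fun hw ↦ ⟨_, norm_diskInvolution_lt_one ha hw, diskInvolution_diskInvolution ha hw.le⟩

theorem injOn_diskInvolution_ball (ha : ‖a‖ < 1) : Set.InjOn (diskInvolution a) (ball 0 1) :=
  Set.LeftInvOn.injOn fun _ hz ↦ diskInvolution_diskInvolution ha (mem_ball_zero_iff.1 hz).le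

end diskInvolution

theorem abs_det_restrictScalars_toSpanSingleton (c : ℂ) :
    |((ContinuousLinearMap.toSpanSingleton ℂ c).restrictScalars ℝ).det| = ‖c‖ ^ 2 := by
  simp [ContinuousLinearMap.det, LinearMap.det_restrictScalars, Algebra.norm_complex_eq,
    Complex.normSq_eq_norm_sq]

/-- Conformal invariance of the Dirichlet energy. -/
theorem integral_norm_deriv_comp_diskInvolution_sq {a : ℂ} (ha : ‖a‖ < 1) {f : ℂ → ℂ}
    (hf : DifferentiableOn ℂ f (ball 0 1)) :
    ∫ z in ball (0 : ℂ) 1, ‖deriv (f ∘ diskInvolution a) z‖ ^ 2 =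
      ∫ z in ball (0 : ℂ) 1, ‖deriv f z‖ ^ 2 := by
  have hφ : ∀ z ∈ ball (0 : ℂ) 1, DifferentiableAt ℂ (diskInvolution a) z := fun z hz ↦
    (analyticAt_diskInvolution ha (mem_ball_zero_iff.1 hz).le).differentiableAt
  have hcv := integral_image_eq_integral_abs_det_fderiv_smul volume measurableSet_ball
    (fun z hz ↦ ((hφ z hz).hasDerivAt.hasFDerivAt.restrictScalars ℝ).hasFDerivWithinAt)
    (injOn_diskInvolution_ball ha) fun z ↦ ‖deriv f z‖ ^ 2
  rw [image_diskInvolution_ball ha] at hcv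
  rw [hcv]
  refine setIntegral_congr_fun measurableSet_ball fun z hz ↦ ?_
  have hfz : DifferentiableAt ℂ f (diskInvolution a z) := hf.differentiableAt
    (isOpen_ball.mem_nhds
      (mem_ball_zero_iff.2 (norm_diskInvolution_lt_one ha (mem_ball_zero_iff.1 hz))))
  simp only [abs_det_restrictScalars_toSpanSingleton, deriv_comp z hfz (hφ z hz), norm_mul,
    smul_eq_mul]
  ring

/-! ### Blaschke factors -/

theorem analyticOnNhd_blaschkeFactor {a : ℂ} (ha : ‖a‖ < 1) :
    AnalyticOnNhd ℂ (fun z ↦ (z - a) / (1 - conj a * z)) (closedBall 0 1) := fun _ hz ↦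
  (analyticAt_id.sub analyticAt_const).div
    (analyticAt_const.sub (analyticAt_const.mul analyticAt_id))
    (one_sub_conj_mul_ne_zero ha (mem_closedBall_zero_iff.1 hz))

theorem AnalyticOnNhd.differentiableOn_ball_of_closedBall {f : ℂ → ℂ}
    (hf : AnalyticOnNhd ℂ f (closedBall 0 1)) : DifferentiableOn ℂ f (ball 0 1) :=
  hf.differentiableOn.mono ball_subset_closedBall

theorem integral_norm_deriv_sq_le_blaschkeFactor_mul {a : ℂ} (ha : ‖a‖ < 1) {f : ℂ → ℂ}
    (hf : AnalyticOnNhd ℂ f (closedBall 0 1)) :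
    ∫ z in ball (0 : ℂ) 1, ‖deriv f z‖ ^ 2 ≤
      ∫ z in ball (0 : ℂ) 1, ‖deriv (fun w ↦ (w - a) / (1 - conj a * w) * f w) z‖ ^ 2 := by
  have hbf := (analyticOnNhd_blaschkeFactor ha).mul hf
  have hg : AnalyticOnNhd ℂ (f ∘ diskInvolution a) (closedBall 0 1) := fun z hz ↦ by
    have hz' := mem_closedBall_zero_iff.1 hz
    exact (hf _ (mem_closedBall_zero_iff.2 (norm_diskInvolution_le_one ha hz'))).comp
      (analyticAt_diskInvolution ha hz')
  rw [← integral_norm_deriv_comp_diskInvolution_sq ha hf.differentiableOn_ball_of_closedBall,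
    ← integral_norm_deriv_comp_diskInvolution_sq ha hbf.differentiableOn_ball_of_closedBall]
  refine (integral_norm_deriv_sq_le_id_mul hg).trans_eq ?_
  refine setIntegral_congr_fun measurableSet_ball fun z hz ↦ ?_
  have heq : Set.EqOn ((fun w ↦ (w - a) / (1 - conj a * w) * f w) ∘ diskInvolution a)
      (-fun w ↦ w * (f ∘ diskInvolution a) w) (ball 0 1) := fun w hw ↦ by
    have hinv : (a - diskInvolution a w) / (1 - conj a * diskInvolution a w) = w :=
      diskInvolution_diskInvolution ha (mem_ball_zero_iff.1 hw).le
    simp only [Function.comp_apply, Pi.neg_apply]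
    rw [← neg_sub a, neg_div, hinv, neg_mul]
  have hderiv := (heq.eventuallyEq_of_mem (isOpen_ball.mem_nhds hz)).deriv_eq
  rw [deriv.neg] at hderiv
  exact congrArg (· ^ 2) (by rw [← norm_neg, ← hderiv])

theorem integral_norm_deriv_sq_le_prod_blaschkeFactor_mul {ι : Type*} (s : Finset ι) {α : ι → ℂ}
    (hα : ∀ j ∈ s, ‖α j‖ < 1) {f : ℂ → ℂ} (hf : AnalyticOnNhd ℂ f (closedBall 0 1)) :
    ∫ z in ball (0 : ℂ) 1, ‖deriv f z‖ ^ 2 ≤ ∫ z in ball (0 : ℂ) 1,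
      ‖deriv (fun w ↦ (∏ j ∈ s, (w - α j) / (1 - conj (α j) * w)) * f w) z‖ ^ 2 := by
  classical
  induction s using Finset.induction_on with
  | empty => simp
  | insert i s his ih =>
    have hs : ∀ j ∈ s, ‖α j‖ < 1 := fun j hj ↦ hα j (Finset.mem_insert_of_mem hj)
    have hprod : AnalyticOnNhd ℂ
        (fun w ↦ (∏ j ∈ s, (w - α j) / (1 - conj (α j) * w)) * f w) (closedBall 0 1) :=
      (s.analyticOnNhd_fun_prod fun j hj ↦ analyticOnNhd_blaschkeFactor (hs j hj)).mul hf
    simp_rw [Finset.prod_insert his, mul_assoc]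
    exact (ih hs).trans
      (integral_norm_deriv_sq_le_blaschkeFactor_mul (hα i (Finset.mem_insert_self i s)) hprod)

/-- Monotonicity of the Dirichlet energy under Blaschke factorization: if `F = B·G` where `B`
is a finite Blaschke product with zeros in the open unit disk and `G` is holomorphic and
zero-free on a neighborhood of the closed unit disk, then the Dirichlet integral of `G` is
at most that of `F`. -/
theorem dirichlet_energy_mono (J : ℕ) (hJ : 1 ≤ J) (α : Fin J → ℂ) (hα : ∀ j, ‖α j‖ < 1)
    (G : ℂ → ℂ) (U : Set ℂ) (hU : IsOpen U) (hUc : Metric.closedBall (0:ℂ) 1 ⊆ U)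
    (hG : DifferentiableOn ℂ G U) (hGne : ∀ z : ℂ, ‖z‖ ≤ 1 → G z ≠ 0)
    (B F : ℂ → ℂ)
    (hB : ∀ z, B z = ∏ j, (z - α j) / (1 - (starRingEnd ℂ) (α j) * z))
    (hF : ∀ z, F z = B z * G z) :
    (∫ z in Metric.ball (0:ℂ) 1, ‖deriv G z‖ ^ 2) ≤
      ∫ z in Metric.ball (0:ℂ) 1, ‖deriv F z‖ ^ 2 := by
  have hFeq : F = fun w ↦ (∏ j, (w - α j) / (1 - conj (α j) * w)) * G w :=
    funext fun w ↦ by rw [hF, hB]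
  rw [hFeq]
  exact integral_norm_deriv_sq_le_prod_blaschkeFactor_mul Finset.univ (fun j _ ↦ hα j)
    ((hG.analyticOnNhd hU).mono hUc)
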